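/- Suppose ℙ and ℚ are stationary measures on Ω with supp ℚ ⊆ supp ℙ, ℙ satisfies FE and SE with constants γ_+ < 0 and γ_- < 0, and ℚ satisfies conditions ID and FE (with the same constant γ_+). Fix ε ∈ (0,1/2) and 0 < α < γ_+/(8γ_-), and consider the block auxiliary parsing of y_1^N with M_N blocks. Then for ℚ-almost every y there exists N_ε(y) such that #S_b(y_1^N) < ε M_N for all N ≥ N_ε(y). -/

import Mathlib

open MeasureTheory Filter Asymptotics
open scoped ENNReal Classical

noncomputable section

namespace ZM

/-- The left shift on one-sided sequences. -/
def shift {A : Type*} (x : ℕ → A) : ℕ → A := fun k => x (k + 1)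

/-- The cylinder set of all sequences starting with the word `a`. -/
def cyl {A : Type*} {n : ℕ} (a : Fin n → A) : Set (ℕ → A) := {x | ∀ i : Fin n, x i = a i}

/-- The word `x_{p+1}^{p+ℓ}` of `x` (0-based: the letters at positions `p, …, p+ℓ-1`). -/
def seg {A : Type*} (y : ℕ → A) (p ℓ : ℕ) : Fin ℓ → A := fun i => y (p + i)

/-- `w` occurs in `x` at (0-based) offset `r`. -/
def matchAt {A : Type*} (x : ℕ → A) {ℓ : ℕ} (w : Fin ℓ → A) (r : ℕ) : Prop :=
  ∀ i : Fin ℓ, x (r + i) = w i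

/-- `w` appears as a substring of `x_1^N`. -/
def appears {A : Type*} (N : ℕ) (x : ℕ → A) {ℓ : ℕ} (w : Fin ℓ → A) : Prop :=
  ∃ r, r + ℓ ≤ N ∧ matchAt x w r

/-- The waiting time `W_ℓ(w, x)`: the least (1-based) position at which `w` occurs in `x`,
`⊤` if `w` never occurs. -/
def W {A : Type*} {ℓ : ℕ} (w : Fin ℓ → A) (x : ℕ → A) : ℕ∞ :=
  sInf {r : ℕ∞ | ∃ n : ℕ, r = (n : ℕ∞) ∧ 1 ≤ n ∧ matchAt x w (n - 1)}

section ZMparsing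

variable {A : Type*}

/-- Length of the Ziv–Merhav word starting at (0-based) position `p` of `y_1^N`, with
database `x_1^N`: the longest prefix of the remaining portion of `y_1^N` appearing as a
substring of `x_1^N`, or a single letter if there is no such prefix. -/
def zmLen (N : ℕ) (x y : ℕ → A) (p : ℕ) : ℕ :=
  max 1 (sSup {ℓ | p + ℓ ≤ N ∧ appears N x (seg y p ℓ)})

/-- Starting position of the `j`-th (0-based) word of the Ziv–Merhav parsing. -/
def zmPos (N : ℕ) (x y : ℕ → A) : ℕ → ℕ
  | 0 => 0
  | j + 1 => zmPos N x y j + zmLen N x y (zmPos N x y j)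

/-- `c_N(y|x)`: the number of words in the Ziv–Merhav parsing of `y_1^N` w.r.t. `x_1^N`. -/
def cN (N : ℕ) (x y : ℕ → A) : ℕ := sInf {c | N ≤ zmPos N x y c}

/-- The Ziv–Merhav estimator `Q̂_N(y, x) = c_N(y|x) ln N / N`. -/
def ZMest (N : ℕ) (x y : ℕ → A) : ℝ := (cN N x y : ℝ) * Real.log N / N

end ZMparsing

section MeasureDefs

variable {A : Type*} [MeasurableSpace A]

/-- The measure of the cylinder of a word, as a real number. -/
def wp (μ : Measure (ℕ → A)) {n : ℕ} (a : Fin n → A) : ℝ := (μ (cyl a)).toReal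

/-- `supp ℙ`: the set of sequences all of whose prefixes have positive measure. -/
def suppSet (μ : Measure (ℕ → A)) : Set (ℕ → A) := {x | ∀ n, 0 < μ (cyl (seg x 0 n))}

/-- Condition (ID): immediate decoupling on the support, with sequence `k`. -/
def CondID (μ : Measure (ℕ → A)) (k : ℕ → ℝ) : Prop :=
  Monotone k ∧ (k =o[atTop] fun n => (n : ℝ)) ∧
    ∀ (n m : ℕ) (a : Fin n → A) (b : Fin m → A), 0 < μ (cyl a) → 0 < μ (cyl b) →
      wp μ (Fin.append a b) ≤ Real.exp (k n) * (wp μ a * wp μ b) ∧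
      (0 < μ (cyl (Fin.append a b)) →
        Real.exp (-k n) * (wp μ a * wp μ b) ≤ wp μ (Fin.append a b))

/-- Condition (FE): fast enough decay, with rate `γp < 0`. -/
def CondFE (μ : Measure (ℕ → A)) (γp : ℝ) : Prop :=
  γp < 0 ∧ ∀ᶠ n : ℕ in atTop, ∀ a : Fin n → A, 0 < μ (cyl a) → wp μ a ≤ Real.exp (γp * n)

/-- Condition (SE): slow enough decay, with rate `γm < 0`. -/
def CondSE (μ : Measure (ℕ → A)) (γm : ℝ) : Prop :=
  γm < 0 ∧ ∀ᶠ n : ℕ in atTop, ∀ a : Fin n → A, 0 < μ (cyl a) → Real.exp (γm * n) ≤ wp μ a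

/-- Condition (KB): Kontoyiannis' bound on waiting times, with sequences `k`, `τ`. -/
def CondKB (μ : Measure (ℕ → A)) (k τ : ℕ → ℝ) : Prop :=
  (k =o[atTop] fun n => (n : ℝ)) ∧ (τ =o[atTop] fun n => (n : ℝ)) ∧
    ∀ (ℓ : ℕ) (a : Fin ℓ → A) (r : ℕ),
      (μ {x | (r : ℕ∞) ≤ W a x}).toReal ≤
        Real.exp (-(Real.exp (-k ℓ) * wp μ a * (⌊((r : ℝ) - 1) / ((ℓ : ℝ) + τ ℓ)⌋ : ℝ)))

/-- Length of the next word of the auxiliary parsing of `y_1^N` starting at position `p`: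
the shortest prefix of the remaining portion of `y_1^N` with measure at most `θ`, or the
whole remaining portion if there is no such prefix. -/
def auxLen (μ : Measure (ℕ → A)) (θ : ℝ) (N : ℕ) (y : ℕ → A) (p : ℕ) : ℕ :=
  if ∃ ℓ, 1 ≤ ℓ ∧ p + ℓ ≤ N ∧ wp μ (seg y p ℓ) ≤ θ then
    sInf {ℓ | 1 ≤ ℓ ∧ p + ℓ ≤ N ∧ wp μ (seg y p ℓ) ≤ θ}
  else N - p

/-- Starting position of the `j`-th (0-based) word of the auxiliary parsing. -/
def auxPos (μ : Measure (ℕ → A)) (θ : ℝ) (N : ℕ) (y : ℕ → A) : ℕ → ℕ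
  | 0 => 0
  | j + 1 => auxPos μ θ N y j + max 1 (auxLen μ θ N y (auxPos μ θ N y j))

/-- Length of the `j`-th (0-based) word of the auxiliary parsing. -/
def auxWordLen (μ : Measure (ℕ → A)) (θ : ℝ) (N : ℕ) (y : ℕ → A) (j : ℕ) : ℕ :=
  max 1 (auxLen μ θ N y (auxPos μ θ N y j))

/-- The number of words in the auxiliary parsing of `y_1^N`. -/
def auxCount (μ : Measure (ℕ → A)) (θ : ℝ) (N : ℕ) (y : ℕ → A) : ℕ :=
  sInf {c | N ≤ auxPos μ θ N y c}

/-- Length of the next word of the block parsing within a block ending at position `e`: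
the shortest prefix of the remaining portion of the block with measure at most `θ`;
`0` encodes that no such prefix exists (the rest of the block is the buffer). -/
def blkLen (μ : Measure (ℕ → A)) (θ : ℝ) (e : ℕ) (y : ℕ → A) (p : ℕ) : ℕ :=
  sInf {ℓ | 1 ≤ ℓ ∧ p + ℓ ≤ e ∧ wp μ (seg y p ℓ) ≤ θ}

/-- Starting position of the `i`-th (0-based) word of the block starting at `q`, ending at `e`. -/
def blkPos (μ : Measure (ℕ → A)) (θ : ℝ) (e : ℕ) (y : ℕ → A) (q : ℕ) : ℕ → ℕ
  | 0 => q
  | i + 1 => blkPos μ θ e y q i + blkLen μ θ e y (blkPos μ θ e y q i)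

/-- Number `d_s` of words in the block starting at `q` and ending at `e`. -/
def dCount (μ : Measure (ℕ → A)) (θ : ℝ) (e : ℕ) (y : ℕ → A) (q : ℕ) : ℕ :=
  sInf {i | blkLen μ θ e y (blkPos μ θ e y q i) = 0}

/-- The block starting at `q` and ending at `e` is good: its parsed words are pairwise
distinct. -/
def GoodBlock (μ : Measure (ℕ → A)) (θ : ℝ) (e : ℕ) (y : ℕ → A) (q : ℕ) : Prop :=
  ∀ i j : ℕ, i < dCount μ θ e y q → j < dCount μ θ e y q →
    blkLen μ θ e y (blkPos μ θ e y q i) = blkLen μ θ e y (blkPos μ θ e y q j) →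
    (∀ t < blkLen μ θ e y (blkPos μ θ e y q i),
      y (blkPos μ θ e y q i + t) = y (blkPos μ θ e y q j + t)) →
    i = j

end MeasureDefs

/-- The block length `⌊N^α⌋`. -/
def blockB (N : ℕ) (α : ℝ) : ℕ := ⌊(N : ℝ) ^ α⌋₊

/-- The number `M_N` of blocks. -/
def blockM (N : ℕ) (α : ℝ) : ℕ := (N + blockB N α - 1) / blockB N α

/-- The starting position of the `s`-th (0-based) block. -/
def blockStart (N : ℕ) (α : ℝ) (s : ℕ) : ℕ := s * blockB N α

/-- The end position of the `s`-th (0-based) block. -/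
def blockEnd (N : ℕ) (α : ℝ) (s : ℕ) : ℕ := min ((s + 1) * blockB N α) N

/-- `S_b(y_1^N)`: the set of bad blocks of the block auxiliary parsing (with threshold
`N^{-1-ε}`, word probabilities computed with `μ`). -/
def badSet {A : Type*} [MeasurableSpace A] (μ : Measure (ℕ → A)) (N : ℕ) (α ε : ℝ)
    (y : ℕ → A) : Set ℕ :=
  {s | s < blockM N α ∧
    ¬ GoodBlock μ ((N : ℝ) ^ (-1 - ε)) (blockEnd N α s) y (blockStart N α s)}

/-- `ℓ₋ = ln N / (-2 γ₋)`. -/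
def ellMinus (N : ℕ) (γm : ℝ) : ℝ := Real.log N / (-2 * γm)

/-- `ℓ₊ = 2 ln N / (-γ₊)`. -/
def ellPlus (N : ℕ) (γp : ℝ) : ℝ := 2 * Real.log N / (-γp)

/-- `d₊ = 2 N^α / ℓ₋`. -/
def dPlus (N : ℕ) (α γm : ℝ) : ℝ := 2 * (N : ℝ) ^ α / ellMinus N γm

section CrossEntropy

variable {A : Type*} [MeasurableSpace A] [Fintype A]

/-- The `n`-th cross-entropy average `-(1/n) ∑_{a ∈ 𝒜ⁿ} ℚ[a] ln ℙ[a]`, real-valued version. -/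
def hcSeq (μP μQ : Measure (ℕ → A)) (n : ℕ) : ℝ :=
  -(1 / (n : ℝ)) * ∑ a : Fin n → A, wp μQ a * Real.log (wp μP a)

/-- `-ln p` as an element of `[0, ∞]`, for `p ∈ [0, 1]`; equals `⊤` when `p = 0`. -/
def negLog (p : ℝ≥0∞) : ℝ≥0∞ := if p = 0 then ⊤ else ENNReal.ofReal (-Real.log p.toReal)

/-- The `n`-th cross-entropy average, `[0, ∞]`-valued version. -/
def hcSeqE (μP μQ : Measure (ℕ → A)) (n : ℕ) : ℝ≥0∞ :=
  (∑ a : Fin n → A, μQ (cyl a) * negLog (μP (cyl a))) / (n : ℝ≥0∞)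

end CrossEntropy

end ZM

namespace ZM

lemma iterate_shift_apply {A : Type*} (g : ℕ) (x : ℕ → A) (i : ℕ) :
    (shift^[g] x) i = x (g + i) := by
  induction g generalizing x with
  | zero => simp
  | succ g ih => rw [Function.iterate_succ_apply, ih]; simp [shift]; congr 1; omega

/-- Membership in `F` depends only on the first `m` letters. -/
def DependsOnPrefix {A : Type*} (m : ℕ) (F : Set (ℕ → A)) : Prop :=
  ∀ x y : ℕ → A, (∀ i < m, x i = y i) → x ∈ F → y ∈ F

/-- The sequences whose first `B` letters contain two disjoint copies of a word of length `L`. -/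
def repeatSet {A : Type*} (B L : ℕ) : Set (ℕ → A) :=
  {y | ∃ p p', p + L ≤ p' ∧ p' + L ≤ B ∧ ∀ i < L, y (p + i) = y (p' + i)}

/-- At least `k` of the first `M` blocks of length `B` contain a repeated word of length `L`. -/
def manyRepeats {A : Type*} (B L M k : ℕ) : Set (ℕ → A) :=
  {y | k ≤ Nat.count (fun s => shift^[s * B] y ∈ repeatSet B L) M}

namespace DependsOnPrefix

variable {A : Type*}

lemma preimage {m : ℕ} {F : Set (ℕ → A)} (hF : DependsOnPrefix m F) (g : ℕ) :
    DependsOnPrefix (g + m) (shift^[g] ⁻¹' F) := by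
  intro x y hxy hx
  refine hF _ _ (fun i hi => ?_) hx
  rw [iterate_shift_apply, iterate_shift_apply]
  exact hxy _ (by omega)

lemma cyl_inter {m n : ℕ} {F : Set (ℕ → A)} (hF : DependsOnPrefix m F) (a : Fin n → A) :
    DependsOnPrefix (n + m) (cyl a ∩ F) := by
  rintro x y hxy ⟨hx, hx'⟩
  refine ⟨fun i => ?_, hF _ _ (fun i hi => hxy i (by omega)) hx'⟩
  rw [← hxy i (by omega)]
  exact hx i

lemma eq_iUnion {m : ℕ} {F : Set (ℕ → A)} (hF : DependsOnPrefix m F) :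
    F = ⋃ b : {b : Fin m → A // cyl b ⊆ F}, cyl b.1 := by
  ext x
  simp only [Set.mem_iUnion]
  refine ⟨fun hx => ⟨⟨fun i => x i, fun y hy => hF x y (fun i hi => (hy ⟨i, hi⟩).symm) hx⟩,
    fun i => rfl⟩, ?_⟩
  rintro ⟨b, hb⟩
  exact b.2 hb

end DependsOnPrefix

lemma cyl_disjoint {A : Type*} {n : ℕ} {a b : Fin n → A} (h : a ≠ b) :
    Disjoint (cyl a) (cyl b) := by
  rw [Set.disjoint_left]
  exact fun x ha hb => h (funext fun i => (ha i).symm.trans (hb i))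

lemma cyl_append {A : Type*} {n m : ℕ} (a : Fin n → A) (b : Fin m → A) :
    cyl (Fin.append a b) = cyl a ∩ shift^[n] ⁻¹' cyl b := by
  ext x
  simp only [cyl, Set.mem_ofPred_eq, Set.mem_inter_iff, Set.mem_preimage, iterate_shift_apply]
  constructor
  · intro h
    exact ⟨fun i => by simpa using h (Fin.castAdd m i), fun i => by simpa using h (Fin.natAdd n i)⟩
  · rintro ⟨h1, h2⟩ i
    refine Fin.addCases (fun i => ?_) (fun i => ?_) i
    · simpa using h1 i
    · simpa using h2 i

lemma dependsOnPrefix_repeatSet {A : Type*} (B L : ℕ) :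
    DependsOnPrefix B (repeatSet B L : Set (ℕ → A)) := by
  rintro x y hxy ⟨p, p', h1, h2, h⟩
  refine ⟨p, p', h1, h2, fun i hi => ?_⟩
  rw [← hxy _ (by omega), ← hxy _ (by omega)]
  exact h i hi

lemma dependsOnPrefix_manyRepeats {A : Type*} (B L M k : ℕ) :
    DependsOnPrefix (M * B) (manyRepeats B L M k : Set (ℕ → A)) := by
  intro x y hxy hx
  refine le_trans (b := Nat.count (fun s => shift^[s * B] x ∈ repeatSet B L) M) hx ?_
  rw [Nat.count_eq_card_filter_range, Nat.count_eq_card_filter_range]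
  refine Finset.card_le_card fun s hs => ?_
  rw [Finset.mem_filter, Finset.mem_range] at hs ⊢
  refine ⟨hs.1, dependsOnPrefix_repeatSet B L _ _ (fun i hi => ?_) hs.2⟩
  rw [iterate_shift_apply, iterate_shift_apply]
  refine hxy _ ?_
  calc s * B + i < (s + 1) * B := by rw [Nat.succ_mul]; omega
    _ ≤ M * B := Nat.mul_le_mul_right _ hs.1

lemma manyRepeats_succ_subset {A : Type*} (B L M k : ℕ) :
    (manyRepeats B L (M + 1) (k + 1) : Set (ℕ → A)) ⊆
      shift^[B] ⁻¹' manyRepeats B L M (k + 1) ∪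
        (repeatSet B L ∩ shift^[B] ⁻¹' manyRepeats B L M k) := by
  intro y hy
  have hit : ∀ s, shift^[(s + 1) * B] y = shift^[s * B] (shift^[B] y) := by
    intro s; rw [← Function.iterate_add_apply, Nat.succ_mul]
  simp only [manyRepeats, Set.mem_ofPred_eq, Nat.count_succ', hit, zero_mul,
    Function.iterate_zero, id] at hy
  simp only [manyRepeats, Set.mem_union, Set.mem_inter_iff, Set.mem_preimage, Set.mem_ofPred_eq]
  split_ifs at hy with h
  · exact Or.inr ⟨h, by omega⟩
  · exact Or.inl hy

section Discrete

variable {A : Type*} [MeasurableSpace A] [MeasurableSingletonClass A]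

lemma measurableSet_cyl {n : ℕ} (a : Fin n → A) : MeasurableSet (cyl a) := by
  have : cyl a = ⋂ i : Fin n, (fun x : ℕ → A => x i) ⁻¹' {a i} := by
    ext x; simp [cyl]
  rw [this]
  exact MeasurableSet.iInter fun i => measurable_pi_apply _ (measurableSet_singleton _)

variable [Finite A]

lemma DependsOnPrefix.measurableSet {m : ℕ} {F : Set (ℕ → A)} (hF : DependsOnPrefix m F) :
    MeasurableSet F := by
  rw [hF.eq_iUnion]
  exact MeasurableSet.iUnion fun b => measurableSet_cyl _

lemma sum_measure_cyl {A : Type*} [MeasurableSpace A] [MeasurableSingletonClass A] [Fintype A]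
    (μ : Measure (ℕ → A)) [IsProbabilityMeasure μ] (n : ℕ) :
    ∑ a : Fin n → A, μ (cyl a) = 1 := by
  have h := measure_iUnion (μ := μ) (f := fun a : Fin n → A => cyl a)
    (fun a b h => cyl_disjoint h) measurableSet_cyl
  rw [tsum_fintype] at h
  rw [← h, ← measure_univ (μ := μ)]
  congr 1
  exact Set.eq_univ_of_forall fun x => Set.mem_iUnion.2 ⟨fun i => x i, fun i => rfl⟩

/-- Decoupling of a word from the future, extended from cylinders to finitely determined events. -/
lemma measure_cyl_inter_le {μ : Measure (ℕ → A)} [IsProbabilityMeasure μ]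
    (hstat : MeasurePreserving shift μ μ) {k : ℕ → ℝ} (hID : CondID μ k)
    {L m g : ℕ} (hg : L ≤ g) (a : Fin L → A) {F : Set (ℕ → A)} (hF : DependsOnPrefix m F) :
    μ (cyl a ∩ shift^[g] ⁻¹' F) ≤ ENNReal.ofReal (Real.exp (k L)) * μ (cyl a) * μ F := by
  have _ := Fintype.ofFinite A
  have base : ∀ {m : ℕ} {F : Set (ℕ → A)}, DependsOnPrefix m F →
      μ (cyl a ∩ shift^[L] ⁻¹' F) ≤ ENNReal.ofReal (Real.exp (k L)) * μ (cyl a) * μ F := by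
    intro m F hF
    have hsum : μ F = ∑ b : {b : Fin m → A // cyl b ⊆ F}, μ (cyl b.1) := by
      conv_lhs => rw [hF.eq_iUnion]
      rw [measure_iUnion (fun b c h => cyl_disjoint fun h' => h (Subtype.ext h'))
        fun b => measurableSet_cyl _, tsum_fintype]
    have hsub : cyl a ∩ shift^[L] ⁻¹' F ⊆
        ⋃ b : {b : Fin m → A // cyl b ⊆ F}, cyl (Fin.append a b.1) := by
      rintro x ⟨hx, hx'⟩
      rw [Set.mem_preimage, hF.eq_iUnion, Set.mem_iUnion] at hx'
      obtain ⟨b, hb⟩ := hx'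
      refine Set.mem_iUnion.2 ⟨b, ?_⟩
      rw [cyl_append]
      exact ⟨hx, hb⟩
    refine (measure_mono hsub).trans ((measure_iUnion_le _).trans ?_)
    rw [tsum_fintype, hsum, Finset.mul_sum]
    refine Finset.sum_le_sum fun b _ => ?_
    rcases eq_or_ne (μ (cyl a)) 0 with ha | ha
    · rw [cyl_append, measure_mono_null Set.inter_subset_left ha]; exact zero_le
    rcases eq_or_ne (μ (cyl b.1)) 0 with hb | hb
    · rw [cyl_append, measure_mono_null Set.inter_subset_right]
      · exact zero_le
      · rw [(hstat.iterate L).measure_preimage (measurableSet_cyl _).nullMeasurableSet, hb]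
    have h := (hID.2.2 L m a b.1 (pos_iff_ne_zero.2 ha) (pos_iff_ne_zero.2 hb)).1
    simp only [wp] at h
    rw [← ENNReal.ofReal_toReal (measure_ne_top μ (cyl (Fin.append a b.1)))]
    refine (ENNReal.ofReal_le_ofReal h).trans ?_
    rw [ENNReal.ofReal_mul (Real.exp_pos _).le, ENNReal.ofReal_mul ENNReal.toReal_nonneg,
      ENNReal.ofReal_toReal (measure_ne_top _ _), ENNReal.ofReal_toReal (measure_ne_top _ _),
      mul_assoc]
  obtain ⟨d, rfl⟩ := Nat.exists_eq_add_of_le hg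
  have h := base (hF.preimage d)
  rw [(hstat.iterate d).measure_preimage hF.measurableSet.nullMeasurableSet,
    ← Set.preimage_comp, ← Function.iterate_add, Nat.add_comm d L] at h
  exact h

lemma measure_match_inter_le {μ : Measure (ℕ → A)} [IsProbabilityMeasure μ]
    (hstat : MeasurePreserving shift μ μ) {k : ℕ → ℝ} (hID : CondID μ k)
    {L : ℕ} {q : ℝ≥0∞} (hq : ∀ a : Fin L → A, μ (cyl a) ≤ q)
    {p p' B m : ℕ} (h1 : p + L ≤ p') (h2 : p' + L ≤ B)
    {F : Set (ℕ → A)} (hF : DependsOnPrefix m F) :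
    μ ({y | ∀ i < L, y (p + i) = y (p' + i)} ∩ shift^[B] ⁻¹' F) ≤
      ENNReal.ofReal (Real.exp (k L)) ^ 2 * q * μ F := by
  have _ := Fintype.ofFinite A
  set c := ENNReal.ofReal (Real.exp (k L))
  have hsub : {y : ℕ → A | ∀ i < L, y (p + i) = y (p' + i)} ∩ shift^[B] ⁻¹' F ⊆
      ⋃ a : Fin L → A, shift^[p] ⁻¹'
        (cyl a ∩ shift^[p' - p] ⁻¹' (cyl a ∩ shift^[B - p'] ⁻¹' F)) := by
    rintro y ⟨hy, hyF⟩
    refine Set.mem_iUnion.2 ⟨seg y p L, fun i => iterate_shift_apply _ _ _, fun i => ?_, ?_⟩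
    · rw [← Function.iterate_add_apply, iterate_shift_apply, show p' - p + p = p' by omega]
      exact (hy i i.2).symm
    · rw [Set.mem_preimage, ← Function.iterate_add_apply, ← Function.iterate_add_apply,
        show B - p' + (p' - p) + p = B by omega]
      exact hyF
  have hF1 := hF.preimage (B - p')
  calc μ ({y | ∀ i < L, y (p + i) = y (p' + i)} ∩ shift^[B] ⁻¹' F)
      ≤ ∑ a : Fin L → A, μ (shift^[p] ⁻¹'
        (cyl a ∩ shift^[p' - p] ⁻¹' (cyl a ∩ shift^[B - p'] ⁻¹' F))) := by
        refine (measure_mono hsub).trans ((measure_iUnion_le _).trans ?_)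
        rw [tsum_fintype]
    _ ≤ ∑ a : Fin L → A, c ^ 2 * q * μ F * μ (cyl a) := by
        refine Finset.sum_le_sum fun a _ => ?_
        have hF2 := hF1.cyl_inter a
        rw [(hstat.iterate p).measure_preimage
          ((hF2.preimage (p' - p)).cyl_inter a).measurableSet.nullMeasurableSet]
        calc _ ≤ c * μ (cyl a) * μ (cyl a ∩ shift^[B - p'] ⁻¹' F) :=
              measure_cyl_inter_le hstat hID (by omega) a hF2
          _ ≤ c * μ (cyl a) * (c * q * μ F) := by
              gcongr
              refine (measure_cyl_inter_le hstat hID (by omega) a hF).trans ?_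
              gcongr
              exact hq a
          _ = _ := by ring
    _ = c ^ 2 * q * μ F := by rw [← Finset.mul_sum, sum_measure_cyl, mul_one]

lemma measure_repeatSet_inter_le {μ : Measure (ℕ → A)} [IsProbabilityMeasure μ]
    (hstat : MeasurePreserving shift μ μ) {k : ℕ → ℝ} (hID : CondID μ k)
    {L : ℕ} {q : ℝ≥0∞} (hq : ∀ a : Fin L → A, μ (cyl a) ≤ q)
    {B m : ℕ} {F : Set (ℕ → A)} (hF : DependsOnPrefix m F) :
    μ (repeatSet B L ∩ shift^[B] ⁻¹' F) ≤
      ((B : ℝ≥0∞) + 1) ^ 2 * (ENNReal.ofReal (Real.exp (k L)) ^ 2 * q) * μ F := by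
  set r := ENNReal.ofReal (Real.exp (k L)) ^ 2 * q
  have hsub : (repeatSet B L : Set (ℕ → A)) ∩ shift^[B] ⁻¹' F ⊆
      ⋃ z : Fin (B + 1) × Fin (B + 1), {y | (z.1 + L ≤ (z.2 : ℕ) ∧ z.2 + L ≤ B)} ∩
        ({y | ∀ i < L, y (z.1 + i) = y (z.2 + i)} ∩ shift^[B] ⁻¹' F) := by
    rintro y ⟨⟨p, p', h1, h2, h⟩, hyF⟩
    exact Set.mem_iUnion.2 ⟨(⟨p, by omega⟩, ⟨p', by omega⟩), ⟨h1, h2⟩, h, hyF⟩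
  refine (measure_mono hsub).trans ((measure_iUnion_le _).trans ?_)
  rw [tsum_fintype]
  have hz : ∀ z ∈ (Finset.univ : Finset (Fin (B + 1) × Fin (B + 1))),
      μ ({y | (z.1 + L ≤ (z.2 : ℕ) ∧ z.2 + L ≤ B)} ∩
        ({y | ∀ i < L, y (z.1 + i) = y (z.2 + i)} ∩ shift^[B] ⁻¹' F)) ≤ r * μ F := by
    intro z _
    by_cases hz : z.1 + L ≤ (z.2 : ℕ) ∧ z.2 + L ≤ B
    · exact (measure_mono Set.inter_subset_right).trans
        (measure_match_inter_le hstat hID hq hz.1 hz.2 hF)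
    · simp [hz]
  refine (Finset.sum_le_card_nsmul _ _ _ hz).trans (le_of_eq ?_)
  simp [Fintype.card_prod]
  ring

lemma measure_manyRepeats_le {μ : Measure (ℕ → A)} [IsProbabilityMeasure μ]
    (hstat : MeasurePreserving shift μ μ) {kQ : ℕ → ℝ} (hID : CondID μ kQ)
    {L : ℕ} {q : ℝ≥0∞} (hq : ∀ a : Fin L → A, μ (cyl a) ≤ q) (B M k : ℕ) :
    μ (manyRepeats B L M k) ≤
      2 ^ M * (((B : ℝ≥0∞) + 1) ^ 2 * (ENNReal.ofReal (Real.exp (kQ L)) ^ 2 * q)) ^ k := by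
  set r := ((B : ℝ≥0∞) + 1) ^ 2 * (ENNReal.ofReal (Real.exp (kQ L)) ^ 2 * q)
  induction M generalizing k with
  | zero =>
    cases k with
    | zero => simpa using prob_le_one
    | succ k => simp [manyRepeats]
  | succ M ih =>
    cases k with
    | zero => simpa using prob_le_one.trans (one_le_pow₀ one_le_two)
    | succ k =>
      refine (measure_mono (manyRepeats_succ_subset B L M k)).trans ((measure_union_le _ _).trans ?_)
      rw [(hstat.iterate B).measure_preimage
        (dependsOnPrefix_manyRepeats B L M (k + 1)).measurableSet.nullMeasurableSet]
      calc _ ≤ 2 ^ M * r ^ (k + 1) + r * (2 ^ M * r ^ k) :=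
            add_le_add (ih _) ((measure_repeatSet_inter_le hstat hID hq
              (dependsOnPrefix_manyRepeats B L M k)).trans (by gcongr; exact ih k))
        _ = _ := by ring

end Discrete

section Parsing

variable {A : Type*} [MeasurableSpace A]

lemma blkLen_spec {μ : Measure (ℕ → A)} {θ : ℝ} {e : ℕ} {y : ℕ → A} {p : ℕ}
    (h : blkLen μ θ e y p ≠ 0) :
    p + blkLen μ θ e y p ≤ e ∧ wp μ (seg y p (blkLen μ θ e y p)) ≤ θ :=
  (Nat.sInf_mem (Nat.nonempty_of_sInf_eq_succ (Nat.succ_pred_eq_of_ne_zero h).symm)).2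

lemma blkPos_mono (μ : Measure (ℕ → A)) (θ : ℝ) (e : ℕ) (y : ℕ → A) (q : ℕ) :
    Monotone (blkPos μ θ e y q) :=
  monotone_nat_of_le_succ fun _ => Nat.le_add_right _ _

lemma wp_seg_antitone (μ : Measure (ℕ → A)) [IsProbabilityMeasure μ] (y : ℕ → A) (p : ℕ)
    {l l' : ℕ} (h : l ≤ l') : wp μ (seg y p l') ≤ wp μ (seg y p l) :=
  ENNReal.toReal_mono (measure_ne_top _ _)
    (measure_mono fun _ hx i => hx ⟨i, i.2.trans_le h⟩)

/-- A bad block contains two disjoint copies of a word of length `L`, when words of length at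
most `L` have probability above the threshold. -/
lemma repeat_of_not_goodBlock {μ : Measure (ℕ → A)} [IsProbabilityMeasure μ] {θ : ℝ}
    {e q B L : ℕ} {y : ℕ → A} (hθ : ∀ p, θ < wp μ (seg y p L)) (he : e ≤ q + B)
    (hbad : ¬ GoodBlock μ θ e y q) : shift^[q] y ∈ repeatSet B L := by
  have key : ∀ i j, i < j → i < dCount μ θ e y q → j < dCount μ θ e y q →
      blkLen μ θ e y (blkPos μ θ e y q i) = blkLen μ θ e y (blkPos μ θ e y q j) →
      (∀ t < blkLen μ θ e y (blkPos μ θ e y q i),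
        y (blkPos μ θ e y q i + t) = y (blkPos μ θ e y q j + t)) →
      shift^[q] y ∈ repeatSet B L := by
    intro i j hij hi hj hlen hmatch
    have hne : ∀ i < dCount μ θ e y q, blkLen μ θ e y (blkPos μ θ e y q i) ≠ 0 := fun i hi =>
      Nat.notMem_of_lt_sInf (s := {i | blkLen μ θ e y (blkPos μ θ e y q i) = 0}) hi
    have hi' := blkLen_spec (hne i hi)
    have hj' := blkLen_spec (hne j hj)
    have hL : L ≤ blkLen μ θ e y (blkPos μ θ e y q i) := by
      by_contra! hlt
      exact absurd ((wp_seg_antitone μ y _ hlt.le).trans hi'.2) (not_le.2 (hθ _))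
    have h0 : q ≤ blkPos μ θ e y q i := blkPos_mono μ θ e y q (Nat.zero_le i)
    have h1 : blkPos μ θ e y q i + blkLen μ θ e y (blkPos μ θ e y q i) ≤ blkPos μ θ e y q j :=
      blkPos_mono μ θ e y q hij
    refine ⟨blkPos μ θ e y q i - q, blkPos μ θ e y q j - q, by omega, by omega, fun t ht => ?_⟩
    rw [iterate_shift_apply, iterate_shift_apply,
      show q + (blkPos μ θ e y q i - q + t) = blkPos μ θ e y q i + t by omega,
      show q + (blkPos μ θ e y q j - q + t) = blkPos μ θ e y q j + t by omega]
    exact hmatch t (by omega)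
  unfold GoodBlock at hbad
  push Not at hbad
  obtain ⟨i, j, hi, hj, hlen, hmatch, hne⟩ := hbad
  rcases lt_or_gt_of_ne hne with h | h
  · exact key i j h hi hj hlen hmatch
  · exact key j i h hj hi hlen.symm fun t ht => (hmatch t (hlen ▸ ht)).symm

lemma ncard_badSet_le {μ : Measure (ℕ → A)} [IsProbabilityMeasure μ] {N L : ℕ} {α ε : ℝ}
    {y : ℕ → A} (hθ : ∀ p, (N : ℝ) ^ (-1 - ε) < wp μ (seg y p L)) :
    (badSet μ N α ε y).ncard ≤
      Nat.count (fun s => shift^[s * blockB N α] y ∈ repeatSet (blockB N α) L) (blockM N α) := by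
  rw [Nat.count_eq_card_filter_range, ← Set.ncard_coe_finset]
  refine Set.ncard_le_ncard (fun s hs => ?_) (Finset.finite_toSet _)
  rw [Finset.mem_coe, Finset.mem_filter, Finset.mem_range]
  have he : blockEnd N α s ≤ blockStart N α s + blockB N α := by
    rw [blockEnd, blockStart, ← Nat.succ_mul]
    exact min_le_left _ _
  exact ⟨hs.1, repeat_of_not_goodBlock hθ he hs.2⟩

end Parsing

section Asymptotics

lemma tendsto_log_natCast : Tendsto (fun N : ℕ => Real.log N) atTop atTop :=
  Real.tendsto_log_atTop.comp tendsto_natCast_atTop_atTop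

lemma eventually_repeat_bound_le {γp γm α : ℝ} (hp : γp < 0) (hm : γm < 0)
    (hα : 0 < α ∧ α < γp / (8 * γm)) {k : ℕ → ℝ} (hk : k =o[atTop] fun n => (n : ℝ)) :
    ∀ᶠ N : ℕ in atTop,
      ((blockB N α : ℝ) + 1) ^ 2 * (Real.exp (k ⌊Real.log N / (-γm)⌋₊) ^ 2 *
        Real.exp (γp * ⌊Real.log N / (-γm)⌋₊)) ≤ (N : ℝ) ^ (-(γp / γm / 4)) := by
  have hR : 0 < γp / γm := div_pos_of_neg_of_neg hp hm
  have hL : Tendsto (fun N : ℕ => ⌊Real.log N / (-γm)⌋₊) atTop atTop :=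
    tendsto_nat_floor_atTop.comp (tendsto_log_natCast.atTop_div_const (by linarith))
  have hk' := hL.eventually (hk.bound (show 0 < -γp / 8 by linarith))
  have ht := tendsto_log_natCast.eventually_ge_atTop ((Real.log 4 - γp) / (γp / γm / 4))
  filter_upwards [hk', ht, eventually_ge_atTop 1] with N hkN htN hN
  have hN1 : (1 : ℝ) ≤ N := by exact_mod_cast hN
  have hN0 : (0 : ℝ) < N := by linarith
  have ht0 : 0 ≤ Real.log N := Real.log_nonneg hN1
  set t := Real.log N with htdef
  set L := ⌊t / (-γm)⌋₊ with hLdef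
  have hLle : (L : ℝ) ≤ t / (-γm) := Nat.floor_le (div_nonneg ht0 (by linarith))
  have hLge : t / (-γm) - 1 ≤ L := (Nat.sub_one_lt_floor _).le
  have hrpow : ∀ x : ℝ, (N : ℝ) ^ x = Real.exp (x * t) := fun x => by
    rw [Real.rpow_def_of_pos hN0, mul_comm]
  have hB : (blockB N α : ℝ) + 1 ≤ 2 * Real.exp (α * t) := by
    have h1 : (blockB N α : ℝ) ≤ (N : ℝ) ^ α := Nat.floor_le (by positivity)
    have h2 : (1 : ℝ) ≤ Real.exp (α * t) := Real.one_le_exp (mul_nonneg hα.1.le ht0)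
    rw [hrpow] at h1
    linarith
  have hkL : k L ≤ -γp / 8 * (t / (-γm)) := by
    have h1 := (le_abs_self _).trans hkN
    rw [Real.norm_eq_abs, abs_of_nonneg (Nat.cast_nonneg _)] at h1
    exact h1.trans (mul_le_mul_of_nonneg_left hLle (by linarith))
  have hγL : γp * L ≤ γp * (t / (-γm) - 1) := mul_le_mul_of_nonpos_left hLge hp.le
  calc _ ≤ (2 * Real.exp (α * t)) ^ 2 * (Real.exp (-γp / 8 * (t / (-γm))) ^ 2 *
        Real.exp (γp * (t / (-γm) - 1))) := by gcongr
    _ = Real.exp (Real.log 4 + 2 * (α * t) + 2 * (-γp / 8 * (t / (-γm))) +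
        γp * (t / (-γm) - 1)) := by
      rw [Real.exp_add, Real.exp_add, Real.exp_add, Real.exp_log (by norm_num),
        two_mul (α * t), two_mul (-γp / 8 * (t / (-γm))), Real.exp_add (α * t),
        Real.exp_add (-γp / 8 * (t / (-γm)))]
      ring
    _ ≤ _ := by
      rw [hrpow, Real.exp_le_exp]
      have e1 : -γp / 8 * (t / (-γm)) = γp / γm * t / 8 := by field_simp
      have e2 : γp * (t / (-γm) - 1) = -(γp / γm * t) - γp := by field_simp
      have e3 : γp / (8 * γm) = γp / γm / 8 := by field_simp
      rw [e3] at hα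
      rw [div_le_iff₀ (by positivity)] at htN
      have e4 := mul_le_mul_of_nonneg_right hα.2.le ht0
      rw [e1, e2]
      nlinarith

lemma le_blockM_mul_blockB (N : ℕ) {α : ℝ} (hB : 0 < blockB N α) :
    N ≤ blockM N α * blockB N α := by
  have h := Nat.div_add_mod (N + blockB N α - 1) (blockB N α)
  have h' := Nat.mod_lt (N + blockB N α - 1) hB
  rw [mul_comm] at h
  change N ≤ (N + blockB N α - 1) / blockB N α * blockB N α
  omega

lemma tendsto_blockM {α : ℝ} (hα0 : 0 < α) (hα1 : α < 1) :
    Tendsto (fun N : ℕ => (blockM N α : ℝ)) atTop atTop := by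
  have h := (tendsto_rpow_atTop (show 0 < 1 - α by linarith)).comp
    (tendsto_natCast_atTop_atTop (R := ℝ))
  refine tendsto_atTop_mono' atTop ?_ h
  filter_upwards [eventually_ge_atTop 1] with N hN
  have hN1 : (1 : ℝ) ≤ N := by exact_mod_cast hN
  have hpos : (0 : ℝ) < (N : ℝ) ^ α := by positivity
  have hB : 0 < blockB N α := Nat.floor_pos.2 (Real.one_le_rpow hN1 hα0.le)
  have hle : (blockB N α : ℝ) ≤ (N : ℝ) ^ α := Nat.floor_le hpos.le
  have h1 : (N : ℝ) ≤ blockM N α * blockB N α := by exact_mod_cast le_blockM_mul_blockB N hB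
  simp only [Function.comp_apply]
  rw [Real.rpow_sub (by linarith), Real.rpow_one, div_le_iff₀ hpos]
  exact h1.trans (mul_le_mul_of_nonneg_left hle (Nat.cast_nonneg _))

lemma eventually_two_pow_mul_le {M : ℕ → ℕ} (hM : Tendsto (fun N => (M N : ℝ)) atTop atTop)
    {δ ε : ℝ} (hδ : 0 < δ) (hε : 0 < ε) :
    ∀ᶠ N : ℕ in atTop,
      (2 : ℝ) ^ M N * ((N : ℝ) ^ (-δ)) ^ ⌈ε * M N⌉₊ ≤ (N : ℝ) ^ (-2 : ℝ) := by
  have hδε : 0 < δ * ε := mul_pos hδ hε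
  filter_upwards [hM.eventually_ge_atTop (4 / (δ * ε)), eventually_ge_atTop 1,
    tendsto_log_natCast.eventually_ge_atTop (2 * Real.log 2 / (δ * ε))] with N hMN hN htN
  have hN1 : (1 : ℝ) ≤ N := by exact_mod_cast hN
  have hN0 : (0 : ℝ) < N := by linarith
  have ht0 : 0 ≤ Real.log N := Real.log_nonneg hN1
  have hc : ε * M N ≤ ⌈ε * M N⌉₊ := Nat.le_ceil _
  rw [div_le_iff₀ hδε] at hMN htN
  set t := Real.log N
  have h2 : (2 : ℝ) ^ M N = Real.exp (M N * Real.log 2) := by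
    rw [Real.exp_nat_mul, Real.exp_log (by norm_num)]
  rw [h2, Real.rpow_def_of_pos hN0, Real.rpow_def_of_pos hN0, ← Real.exp_nat_mul, ← Real.exp_add,
    Real.exp_le_exp]
  have h3 := mul_le_mul_of_nonneg_right hc (mul_nonneg ht0 hδ.le)
  have h4 := mul_le_mul_of_nonneg_left htN (Nat.cast_nonneg (α := ℝ) (M N))
  have h5 := mul_le_mul_of_nonneg_right hMN ht0
  nlinarith

end Asymptotics

lemma seg_iterate_shift {A : Type*} (y : ℕ → A) (p n : ℕ) : seg (shift^[p] y) 0 n = seg y p n := by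
  ext i
  simp [seg, iterate_shift_apply]

section Support

variable {A : Type*} [MeasurableSpace A]

lemma ae_shift_mem_suppSet [Finite A] [MeasurableSingletonClass A] {μ : Measure (ℕ → A)}
    (hstat : MeasurePreserving shift μ μ) :
    ∀ᵐ y ∂μ, ∀ p, shift^[p] y ∈ suppSet μ := by
  have h : ∀ᵐ y ∂μ, y ∈ suppSet μ := by
    refine ae_all_iff.2 fun n => ?_
    have hn : ∀ᵐ y ∂μ, ∀ a : Fin n → A, μ (cyl a) = 0 → y ∉ cyl a :=
      ae_all_iff.2 fun a => by
        by_cases ha : μ (cyl a) = 0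
        · filter_upwards [measure_eq_zero_iff_ae_notMem.1 ha] with y hy _ using hy
        · simp [ha]
    filter_upwards [hn] with y hy
    refine pos_iff_ne_zero.2 fun h0 => hy _ h0 fun i => ?_
    simp [seg]
  exact ae_all_iff.2 fun p => (hstat.iterate p).quasiMeasurePreserving.ae h

lemma decay_rate_le {μ : Measure (ℕ → A)} {γp γm : ℝ} (hFE : CondFE μ γp) (hSE : CondSE μ γm)
    {y : ℕ → A} (hy : y ∈ suppSet μ) : γm ≤ γp := by
  obtain ⟨n, hn1, hn2, hn3⟩ := (hFE.2.and (hSE.2.and (eventually_ge_atTop 1))).exists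
  have h := (hn2 _ (hy n)).trans (hn1 _ (hy n))
  rw [Real.exp_le_exp] at h
  have hn : (0 : ℝ) < n := by exact_mod_cast hn3
  exact le_of_mul_le_mul_right h hn

end Support

lemma mostly_good_blocks_of_measurableSingletonClass {A : Type*} [Finite A] [MeasurableSpace A]
    [MeasurableSingletonClass A]
    (μP μQ : Measure (ℕ → A)) [IsProbabilityMeasure μP] [IsProbabilityMeasure μQ]
    (hQstat : MeasurePreserving shift μQ μQ)
    (hsupp : suppSet μQ ⊆ suppSet μP)
    (γp γm : ℝ) (hPFE : CondFE μP γp) (hPSE : CondSE μP γm)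
    (kQ : ℕ → ℝ) (hQID : CondID μQ kQ) (hQFE : CondFE μQ γp)
    (ε α : ℝ) (hε : 0 < ε) (hα : 0 < α ∧ α < γp / (8 * γm)) :
    ∀ᵐ y ∂μQ, ∃ N₀ : ℕ, ∀ N ≥ N₀,
      ((badSet μP N α ε y).ncard : ℝ) < ε * blockM N α := by
  have hp := hQFE.1
  have hm := hPSE.1
  have hae := ae_shift_mem_suppSet hQstat
  obtain ⟨y₀, hy₀⟩ := hae.exists
  have hγ : γm ≤ γp := decay_rate_le hPFE hPSE (hsupp (hy₀ 0))
  have hα1 : α < 1 := by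
    refine hα.2.trans_le ?_
    rw [div_le_one_of_neg (by linarith)]
    linarith
  let L : ℕ → ℕ := fun N => ⌊Real.log N / (-γm)⌋₊
  have hL : Tendsto L atTop atTop :=
    tendsto_nat_floor_atTop.comp (tendsto_log_natCast.atTop_div_const (by linarith))
  let bad : ℕ → Set (ℕ → A) := fun N =>
    manyRepeats (blockB N α) (L N) (blockM N α) ⌈ε * blockM N α⌉₊
  have hbad : ∀ᶠ N in atTop, ‖μQ.real (bad N)‖ ≤ (N : ℝ) ^ (-2 : ℝ) := by
    filter_upwards [hL.eventually hQFE.2, eventually_repeat_bound_le hp hm hα hQID.2.1,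
      eventually_two_pow_mul_le (tendsto_blockM hα.1 hα1)
        (div_pos (div_pos_of_neg_of_neg hp hm) four_pos) hε] with N h1 h2 h3
    have hq : ∀ a : Fin (L N) → A, μQ (cyl a) ≤ ENNReal.ofReal (Real.exp (γp * L N)) := by
      intro a
      rcases eq_or_ne (μQ (cyl a)) 0 with ha | ha
      · rw [ha]; exact zero_le
      · exact (ENNReal.le_ofReal_iff_toReal_le (measure_ne_top _ _) (Real.exp_pos _).le).2
          (h1 a (pos_iff_ne_zero.2 ha))
    have h4 := measure_manyRepeats_le hQstat hQID hq (blockB N α) (blockM N α)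
      ⌈ε * blockM N α⌉₊
    rw [Real.norm_of_nonneg measureReal_nonneg]
    refine (ENNReal.toReal_mono (by finiteness) h4).trans (le_trans ?_ h3)
    simp only [ENNReal.toReal_mul, ENNReal.toReal_pow, ENNReal.toReal_ofNat,
      ENNReal.toReal_ofReal (Real.exp_pos _).le,
      ENNReal.toReal_add (ENNReal.natCast_ne_top _) ENNReal.one_ne_top, ENNReal.toReal_natCast,
      ENNReal.toReal_one]
    gcongr
  have hsummable : Summable fun N => μQ.real (bad N) :=
    Summable.of_norm_bounded_eventually_nat (Real.summable_nat_rpow.2 (by norm_num)) hbad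
  have hBC : ∀ᵐ y ∂μQ, ∀ᶠ N in atTop, y ∉ bad N := by
    refine ae_eventually_notMem ?_
    have h := hsummable.tsum_ofReal_ne_top
    simpa using h
  filter_upwards [hae, hBC] with y hy hyBC
  rw [← eventually_atTop]
  filter_upwards [hyBC, hL.eventually hPSE.2, eventually_ge_atTop 2] with N h1 h2 hN
  have hN2 : (2 : ℝ) ≤ N := by exact_mod_cast hN
  have ht : 0 < Real.log N := Real.log_pos (by linarith)
  have hθ : ∀ p, (N : ℝ) ^ (-1 - ε) < wp μP (seg y p (L N)) := by
    intro p
    have hpos := hsupp (hy p) (L N)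
    rw [seg_iterate_shift] at hpos
    refine lt_of_lt_of_le ?_ (h2 _ hpos)
    rw [Real.rpow_def_of_pos (by linarith), Real.exp_lt_exp]
    have hLle : (L N : ℝ) ≤ Real.log N / (-γm) :=
      Nat.floor_le (div_nonneg ht.le (by linarith))
    rw [le_div_iff₀ (by linarith)] at hLle
    nlinarith
  refine lt_of_le_of_lt (Nat.cast_le.2 (ncard_badSet_le hθ)) (Nat.lt_ceil.1 ?_)
  exact not_le.1 h1

section AtomQuotient

variable {A : Type*} [MeasurableSpace A]

/-- Letters not separated by any measurable set. -/
def atomSetoid (A : Type*) [MeasurableSpace A] : Setoid A where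
  r a b := ∀ S : Set A, MeasurableSet S → (a ∈ S ↔ b ∈ S)
  iseqv := ⟨fun _ _ _ => Iff.rfl, fun h S hS => (h S hS).symm,
    fun h h' S hS => (h S hS).trans (h' S hS)⟩

/-- The alphabet of atoms of the σ-algebra on letters. -/
def AtomAlphabet (A : Type*) [MeasurableSpace A] : Type _ := Quotient (atomSetoid A)

instance : MeasurableSpace (AtomAlphabet A) := ⊤

instance : MeasurableSingletonClass (AtomAlphabet A) := ⟨fun _ => trivial⟩

instance [Finite A] : Finite (AtomAlphabet A) :=
  inferInstanceAs (Finite (Quotient (atomSetoid A)))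

/-- The atom of a letter. -/
def toAtom (a : A) : AtomAlphabet A := Quotient.mk (atomSetoid A) a

/-- The sequence of atoms of a sequence of letters. -/
def toAtoms (x : ℕ → A) : ℕ → AtomAlphabet A := fun i => toAtom (x i)

lemma toAtom_surjective : Function.Surjective (toAtom : A → AtomAlphabet A) :=
  Quotient.mk_surjective

lemma mem_iff_of_toAtom_eq {a b : A} (h : toAtom a = toAtom b) {S : Set A}
    (hS : MeasurableSet S) : a ∈ S ↔ b ∈ S :=
  Quotient.exact (s := atomSetoid A) h S hS

lemma measurable_toAtom [Finite A] : Measurable (toAtom : A → AtomAlphabet A) := by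
  refine measurable_to_countable' fun c => ?_
  obtain ⟨a, rfl⟩ := toAtom_surjective c
  have : toAtom ⁻¹' {toAtom a} = measurableAtom a := by
    ext b
    simp only [Set.mem_preimage, Set.mem_singleton_iff, measurableAtom, Set.mem_iInter]
    refine ⟨fun h S haS hS => (mem_iff_of_toAtom_eq h hS).2 haS, fun h => ?_⟩
    refine Quotient.sound (s := atomSetoid A) fun S hS => ⟨fun hb => ?_, fun ha => h S ha hS⟩
    by_contra ha
    exact h Sᶜ ha hS.compl hb
  rw [this]
  exact MeasurableSet.measurableAtom_of_countable a

lemma measurable_toAtoms [Finite A] : Measurable (toAtoms : (ℕ → A) → ℕ → AtomAlphabet A) :=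
  measurable_pi_lambda _ fun i => measurable_toAtom.comp (measurable_pi_apply i)

lemma mem_iff_of_toAtoms_eq {S : Set (ℕ → A)} (hS : MeasurableSet S) {x y : ℕ → A}
    (h : toAtoms x = toAtoms y) : x ∈ S ↔ y ∈ S := by
  have hpi : (MeasurableSpace.pi : MeasurableSpace (ℕ → A)) ≤
      { MeasurableSet' := fun S => x ∈ S ↔ y ∈ S
        measurableSet_empty := Iff.rfl
        measurableSet_compl := fun S hS => not_congr hS
        measurableSet_iUnion := fun f hf => by
          simp only [Set.mem_iUnion]; exact exists_congr hf } := by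
    refine iSup_le fun i => ?_
    rintro _ ⟨T, hT, rfl⟩
    exact mem_iff_of_toAtom_eq (congrFun h i) hT
  exact hpi S hS

lemma map_toAtoms_cyl [Finite A] (μ : Measure (ℕ → A)) {n : ℕ} (a : Fin n → A) :
    μ.map toAtoms (cyl (toAtom ∘ a)) = μ (cyl a) := by
  rw [Measure.map_apply measurable_toAtoms (measurableSet_cyl _)]
  refine le_antisymm ?_ (measure_mono fun x hx i => congrArg toAtom (hx i))
  rw [← measure_toMeasurable (cyl a)]
  refine measure_mono fun x hx => ?_
  let z : ℕ → A := fun i => if h : i < n then a ⟨i, h⟩ else x i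
  have hz : z ∈ cyl a := fun i => by simp [z]
  have hxz : toAtoms x = toAtoms z := by
    funext i
    by_cases h : i < n
    · simpa [z, h, toAtoms] using hx ⟨i, h⟩
    · simp [z, h, toAtoms]
  exact (mem_iff_of_toAtoms_eq (measurableSet_toMeasurable _ _) hxz).2
    (subset_toMeasurable _ _ hz)

lemma wp_map_toAtoms [Finite A] (μ : Measure (ℕ → A)) {n : ℕ} (a : Fin n → A) :
    wp (μ.map toAtoms) (toAtom ∘ a) = wp μ a := by
  rw [wp, wp, map_toAtoms_cyl]

lemma exists_eq_toAtom_comp {ι : Type*} (a : ι → AtomAlphabet A) : ∃ b : ι → A, a = toAtom ∘ b :=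
  ⟨_, (funext fun i => (toAtom_surjective (a i)).choose_spec).symm⟩

variable [Finite A] {μ : Measure (ℕ → A)}

lemma CondFE.map_toAtoms {γ : ℝ} (h : CondFE μ γ) : CondFE (μ.map toAtoms) γ := by
  refine ⟨h.1, h.2.mono fun n hn a ha => ?_⟩
  obtain ⟨b, rfl⟩ := exists_eq_toAtom_comp a
  rw [map_toAtoms_cyl] at ha
  rw [wp_map_toAtoms]
  exact hn b ha

lemma CondSE.map_toAtoms {γ : ℝ} (h : CondSE μ γ) : CondSE (μ.map toAtoms) γ := by
  refine ⟨h.1, h.2.mono fun n hn a ha => ?_⟩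
  obtain ⟨b, rfl⟩ := exists_eq_toAtom_comp a
  rw [map_toAtoms_cyl] at ha
  rw [wp_map_toAtoms]
  exact hn b ha

lemma CondID.map_toAtoms {k : ℕ → ℝ} (h : CondID μ k) : CondID (μ.map toAtoms) k := by
  refine ⟨h.1, h.2.1, fun n m a b ha hb => ?_⟩
  obtain ⟨a, rfl⟩ := exists_eq_toAtom_comp a
  obtain ⟨b, rfl⟩ := exists_eq_toAtom_comp b
  have happ : Fin.append (toAtom ∘ a) (toAtom ∘ b) = toAtom ∘ Fin.append a b := by
    ext i
    refine Fin.addCases (fun i => ?_) (fun i => ?_) i <;> simp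
  rw [map_toAtoms_cyl] at ha hb
  rw [happ, wp_map_toAtoms, wp_map_toAtoms, wp_map_toAtoms, map_toAtoms_cyl]
  exact h.2.2 n m a b ha hb

lemma toAtoms_mem_suppSet {x : ℕ → A} :
    toAtoms x ∈ suppSet (μ.map toAtoms) ↔ x ∈ suppSet μ :=
  forall_congr' fun n => by
    rw [← map_toAtoms_cyl μ (seg x 0 n)]
    rfl

lemma measurePreserving_shift_map_toAtoms (h : MeasurePreserving shift μ μ) :
    MeasurePreserving shift (μ.map toAtoms) (μ.map toAtoms) := by
  have hm : Measurable (shift : (ℕ → AtomAlphabet A) → _) :=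
    measurable_pi_lambda _ fun i => measurable_pi_apply _
  refine ⟨hm, ?_⟩
  conv_rhs => rw [← h.map_eq]
  rw [Measure.map_map hm measurable_toAtoms, Measure.map_map measurable_toAtoms h.measurable]
  rfl

lemma badSet_subset_map_toAtoms (N : ℕ) (α ε : ℝ) (y : ℕ → A) :
    badSet μ N α ε y ⊆ badSet (μ.map toAtoms) N α ε (toAtoms y) := by
  rintro s ⟨hs, hbad⟩
  refine ⟨hs, fun hgood => hbad ?_⟩
  have hlen : ∀ θ e p, blkLen (μ.map toAtoms) θ e (toAtoms y) p = blkLen μ θ e y p := by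
    intro θ e p
    have hw : ∀ l, wp (μ.map toAtoms) (seg (toAtoms y) p l) = wp μ (seg y p l) :=
      fun l => wp_map_toAtoms μ (seg y p l)
    simp only [blkLen, hw]
  have hpos : ∀ θ e q i, blkPos (μ.map toAtoms) θ e (toAtoms y) q i = blkPos μ θ e y q i := by
    intro θ e q i
    induction i with
    | zero => rfl
    | succ i ih => simp only [blkPos, ih, hlen]
  simp only [GoodBlock, dCount, hlen, hpos] at hgood
  intro i j hi hj h1 h2
  exact hgood i j hi hj h1 fun t ht => congrArg toAtom (h2 t ht)

end AtomQuotient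

/-- **Proposition 3.7.** For `ℚ`-a.e. `y`, eventually fewer than `ε M_N` blocks are bad. -/
theorem mostly_good_blocks {A : Type*} [Fintype A] [MeasurableSpace A]
    (μP μQ : Measure (ℕ → A)) [IsProbabilityMeasure μP] [IsProbabilityMeasure μQ]
    (hPstat : MeasurePreserving shift μP μP)
    (hQstat : MeasurePreserving shift μQ μQ)
    (hsupp : suppSet μQ ⊆ suppSet μP)
    (γp γm : ℝ) (hPFE : CondFE μP γp) (hPSE : CondSE μP γm)
    (kQ : ℕ → ℝ) (hQID : CondID μQ kQ) (hQFE : CondFE μQ γp)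
    (ε α : ℝ) (hε : 0 < ε ∧ ε < 1 / 2) (hα : 0 < α ∧ α < γp / (8 * γm)) :
    ∀ᵐ y ∂μQ, ∃ N₀ : ℕ, ∀ N ≥ N₀,
      ((badSet μP N α ε y).ncard : ℝ) < ε * blockM N α := by
  have _ := Measure.isProbabilityMeasure_map (μ := μP) measurable_toAtoms.aemeasurable
  have _ := Measure.isProbabilityMeasure_map (μ := μQ) measurable_toAtoms.aemeasurable
  have hsupp' : suppSet (μQ.map toAtoms) ⊆ suppSet (μP.map toAtoms) := by
    intro x hx
    obtain ⟨x, rfl⟩ := exists_eq_toAtom_comp x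
    exact toAtoms_mem_suppSet.2 (hsupp (toAtoms_mem_suppSet.1 hx))
  have h := ae_of_ae_map measurable_toAtoms.aemeasurable
    (mostly_good_blocks_of_measurableSingletonClass (μP.map toAtoms) (μQ.map toAtoms)
      (measurePreserving_shift_map_toAtoms hQstat) hsupp' γp γm hPFE.map_toAtoms hPSE.map_toAtoms
      kQ hQID.map_toAtoms hQFE.map_toAtoms ε α hε.1 hα)
  filter_upwards [h] with y hy
  obtain ⟨N₀, hN₀⟩ := hy
  refine ⟨N₀, fun N hN => lt_of_le_of_lt (Nat.cast_le.2 ?_) (hN₀ N hN)⟩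
  exact Set.ncard_le_ncard (badSet_subset_map_toAtoms N α ε y)
    ((Set.finite_lt_nat _).subset fun s hs => hs.1)

end ZM
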